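/- Boundary maximum modulus principle: Let f : Ω → ℍ be a slice regular function on a bounded slice domain Ω. If limsup_{q → q₀} |f(q)| ≤ M for every boundary point q₀ ∈ ∂Ω, then |f(q)| ≤ M for all q ∈ Ω. -/

import Mathlib

open scoped Quaternion

/-- The sphere of imaginary units in the quaternions. -/
def qSphere : Set ℍ[ℝ] := {q : ℍ[ℝ] | q.re = 0 ∧ ‖q‖ = 1}

/-- The point of the slice `L_I = ℝ + ℝI` corresponding to `z = x + iy ∈ ℂ`. -/
noncomputable def toSlice (I : ℍ[ℝ]) (z : ℂ) : ℍ[ℝ] := (z.re : ℍ[ℝ]) + z.im • I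

/-- `f` is slice regular on `Ω`: for each imaginary unit `I`, the restriction of `f` to
`Ω ∩ L_I`, read through the parametrization `toSlice I : ℂ → L_I`, is real differentiable
and satisfies the Cauchy–Riemann equation `∂f/∂x + I ∂f/∂y = 0`. -/
def SliceRegularOn (f : ℍ[ℝ] → ℍ[ℝ]) (Ω : Set ℍ[ℝ]) : Prop :=
  ∀ I ∈ qSphere, ∀ z : ℂ, toSlice I z ∈ Ω →
    ∃ D : ℂ →L[ℝ] ℍ[ℝ],
      HasFDerivWithinAt (fun w => f (toSlice I w)) D (toSlice I ⁻¹' Ω) z ∧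
      D 1 + I * D Complex.I = 0

/-- A slice domain: a domain meeting the real axis all of whose slices are domains. -/
def IsSliceDomain (Ω : Set ℍ[ℝ]) : Prop :=
  IsOpen Ω ∧ IsConnected Ω ∧ (∃ x : ℝ, (x : ℍ[ℝ]) ∈ Ω) ∧
  ∀ I ∈ qSphere, IsConnected (toSlice I ⁻¹' Ω)

/-- `cos θ + I sin θ`. -/
noncomputable def expI (I : ℍ[ℝ]) (θ : ℝ) : ℍ[ℝ] := (Real.cos θ : ℍ[ℝ]) + Real.sin θ • I

/-- The circular cone of opening `φ` around the positive real axis. -/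
def circularCone (φ : ℝ) : Set ℍ[ℝ] :=
  {q : ℍ[ℝ] | ∃ r θ : ℝ, ∃ I ∈ qSphere, 0 < r ∧ |θ| < φ / 2 ∧ q = r • expI I θ}

/-- `M_f(r)`: the maximum of `‖f‖` on the closure of `Ω` intersected with the sphere of radius `r`. -/
noncomputable def maxMod (f : ℍ[ℝ] → ℍ[ℝ]) (Ω : Set ℍ[ℝ]) (r : ℝ) : ℝ :=
  sSup ((fun q => ‖f q‖) '' (closure Ω ∩ Metric.sphere (0 : ℍ[ℝ]) r))

/-- The order of a slice regular function. -/
noncomputable def growthOrder (f : ℍ[ℝ] → ℍ[ℝ]) (Ω : Set ℍ[ℝ]) : EReal :=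
  Filter.limsup (fun r : ℝ =>
    ((max 0 (Real.log (max 0 (Real.log (maxMod f Ω r)))) / Real.log r : ℝ) : EReal))
    Filter.atTop

/-- The type of a slice regular function of order `ρ`. -/
noncomputable def growthType (f : ℍ[ℝ] → ℍ[ℝ]) (Ω : Set ℍ[ℝ]) (ρ : ℝ) : EReal :=
  Filter.limsup (fun r : ℝ => ((max 0 (Real.log (maxMod f Ω r)) / r ^ ρ : ℝ) : EReal))
    Filter.atTop

/-- The angle of opening `φ` bisected by the half line of argument `ζ` in the slice `L_I`. -/
def angleSet (I : ℍ[ℝ]) (ζ φ : ℝ) : Set ℍ[ℝ] :=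
  {q : ℍ[ℝ] | ∃ r θ : ℝ, 0 < r ∧ |θ| < φ / 2 ∧ q = r • expI I (ζ + θ)}

/-- The real affine line through `p` with direction `d`. -/
def lineSet (p d : ℍ[ℝ]) : Set ℍ[ℝ] := {q : ℍ[ℝ] | ∃ t : ℝ, q = p + t • d}

/-- `f` is slice preserving: it maps each slice into itself. -/
def SlicePreservingOn (f : ℍ[ℝ] → ℍ[ℝ]) (Ω : Set ℍ[ℝ]) : Prop :=
  ∀ I ∈ qSphere, ∀ q ∈ Ω ∩ Set.range (toSlice I), f q ∈ Set.range (toSlice I)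

/-- The principal quaternionic logarithm. -/
noncomputable def QLog (q : ℍ[ℝ]) : ℍ[ℝ] :=
  (Real.log ‖q‖ : ℍ[ℝ]) + Real.arccos (q.re / ‖q‖) • (‖q.im‖⁻¹ • q.im)

lemma mul_self_of_mem_qSphere {I : ℍ[ℝ]} (hI : I ∈ qSphere) : I * I = -1 := by
  have h1 : I.re = 0 := hI.1
  have h2 : I.imI * I.imI + I.imJ * I.imJ + I.imK * I.imK = 1 := by
    have h := Quaternion.normSq_eq_norm_mul_self I
    rw [hI.2, Quaternion.normSq_def', h1] at h
    linarith
  ext <;> simp [h1] <;> linarith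

lemma norm_toSlice {I : ℍ[ℝ]} (hI : I ∈ qSphere) (z : ℂ) : ‖toSlice I z‖ = ‖z‖ := by
  have h1 : I.re = 0 := hI.1
  have h2 : I.imI ^ 2 + I.imJ ^ 2 + I.imK ^ 2 = 1 := by
    have h := Quaternion.normSq_eq_norm_mul_self I
    rw [hI.2, Quaternion.normSq_def', h1] at h
    linarith
  rw [← sq_eq_sq₀ (norm_nonneg _) (norm_nonneg _), Complex.sq_norm, Complex.normSq_apply, sq,
    ← Quaternion.normSq_eq_norm_mul_self, Quaternion.normSq_def']
  simp [toSlice, h1]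
  linear_combination z.im ^ 2 * h2

lemma continuous_toSlice (I : ℍ[ℝ]) : Continuous (toSlice I) := by
  unfold toSlice
  exact (Quaternion.continuous_coe.comp Complex.continuous_re).add
    (Complex.continuous_im.smul continuous_const)

lemma qSphere_nonempty : qSphere.Nonempty := by
  obtain ⟨I, h₀, h₁, h₂, h₃⟩ :
      ∃ I : ℍ[ℝ], I.re = 0 ∧ I.imI = 1 ∧ I.imJ = 0 ∧ I.imK = 0 :=
    ⟨⟨0, 1, 0, 0⟩, rfl, rfl, rfl, rfl⟩
  refine ⟨I, h₀, ?_⟩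
  rw [← sq_eq_sq₀ (norm_nonneg _) zero_le_one, sq, ← Quaternion.normSq_eq_norm_mul_self,
    Quaternion.normSq_def', h₀, h₁, h₂, h₃]
  norm_num

lemma exists_toSlice_eq (q : ℍ[ℝ]) : ∃ I ∈ qSphere, ∃ z : ℂ, toSlice I z = q := by
  by_cases h : q.im = 0
  · obtain ⟨I, hI⟩ := qSphere_nonempty
    refine ⟨I, hI, ⟨q.re, 0⟩, ?_⟩
    conv_rhs => rw [← Quaternion.re_add_im q, h]
    simp [toSlice]
  · refine ⟨‖q.im‖⁻¹ • q.im, ⟨by simp, ?_⟩, ⟨q.re, ‖q.im‖⟩, ?_⟩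
    · rw [norm_smul, norm_inv, norm_norm, inv_mul_cancel₀ (norm_ne_zero_iff.2 h)]
    · simp only [toSlice]
      rw [smul_smul, mul_inv_cancel₀ (norm_ne_zero_iff.2 h), one_smul, Quaternion.re_add_im]

/-- The complexification of the real functional `⟪p, ·⟫`, which is complex linear for the complex
structure on `ℍ` given by left multiplication by `I`. -/
noncomputable def sliceFunctional (I p : ℍ[ℝ]) : ℍ[ℝ] →L[ℝ] ℂ :=
  Complex.ofRealCLM ∘L innerSL ℝ p -
    Complex.I • (Complex.ofRealCLM ∘L innerSL ℝ p ∘L ContinuousLinearMap.mul ℝ ℍ[ℝ] I)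

lemma sliceFunctional_apply (I p q : ℍ[ℝ]) :
    sliceFunctional I p q = (inner ℝ p q : ℂ) - Complex.I * (inner ℝ p (I * q) : ℂ) := rfl

lemma sliceFunctional_mul {I : ℍ[ℝ]} (hI : I ∈ qSphere) (p q : ℍ[ℝ]) :
    sliceFunctional I p (I * q) = Complex.I * sliceFunctional I p q := by
  simp only [sliceFunctional_apply, ← mul_assoc, mul_self_of_mem_qSphere hI, neg_one_mul,
    inner_neg_right, Complex.ofReal_neg]
  linear_combination (inner ℝ p (I * q) : ℂ) * Complex.I_mul_I

lemma sliceFunctional_toSlice_mul {I : ℍ[ℝ]} (hI : I ∈ qSphere) (p q : ℍ[ℝ]) (z : ℂ) :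
    sliceFunctional I p (toSlice I z * q) = z * sliceFunctional I p q := by
  rw [toSlice, add_mul, map_add, smul_mul_assoc, map_smul, sliceFunctional_mul hI,
    Quaternion.coe_mul_eq_smul, map_smul, Complex.real_smul, Complex.real_smul]
  conv_rhs => rw [← Complex.re_add_im z]
  ring

lemma re_sliceFunctional (I p q : ℍ[ℝ]) : (sliceFunctional I p q).re = inner ℝ p q := by
  simp [sliceFunctional_apply]

lemma norm_sliceFunctional_le {I : ℍ[ℝ]} (hI : I ∈ qSphere) (p q : ℍ[ℝ]) :
    ‖sliceFunctional I p q‖ ≤ ‖p‖ * ‖q‖ := by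
  set c := sliceFunctional I p q with hc
  have h : ‖c‖ * ‖c‖ ≤ ‖c‖ * (‖p‖ * ‖q‖) := by
    calc ‖c‖ * ‖c‖ = (sliceFunctional I p (toSlice I (starRingEnd ℂ c) * q)).re := by
          rw [sliceFunctional_toSlice_mul hI, ← hc, mul_comm _ c, Complex.mul_conj,
            Complex.ofReal_re, Complex.normSq_eq_norm_sq, sq]
      _ ≤ ‖p‖ * ‖toSlice I (starRingEnd ℂ c) * q‖ := by
          rw [re_sliceFunctional]
          exact real_inner_le_norm _ _
      _ = ‖c‖ * (‖p‖ * ‖q‖) := by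
          rw [norm_mul, norm_toSlice hI, RCLike.norm_conj]
          ring
  rcases (norm_nonneg c).eq_or_lt with h0 | h0
  · rw [← h0]
    positivity
  · exact le_of_mul_le_mul_left h h0

lemma SliceRegularOn.exists_hasFDerivAt {f : ℍ[ℝ] → ℍ[ℝ]} {Ω : Set ℍ[ℝ]}
    (hf : SliceRegularOn f Ω) (hΩ : IsOpen Ω) {I : ℍ[ℝ]} (hI : I ∈ qSphere) {z : ℂ}
    (hz : toSlice I z ∈ Ω) :
    ∃ D : ℂ →L[ℝ] ℍ[ℝ], HasFDerivAt (fun w => f (toSlice I w)) D z ∧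
      D Complex.I = I * D 1 := by
  obtain ⟨D, hD, hCR⟩ := hf I hI z hz
  refine ⟨D, hD.hasFDerivAt ((hΩ.preimage (continuous_toSlice I)).mem_nhds hz), ?_⟩
  rw [eq_neg_of_add_eq_zero_left hCR, mul_neg, ← mul_assoc, mul_self_of_mem_qSphere hI,
    neg_one_mul, neg_neg]

lemma SliceRegularOn.differentiableAt_sliceFunctional {f : ℍ[ℝ] → ℍ[ℝ]} {Ω : Set ℍ[ℝ]}
    (hf : SliceRegularOn f Ω) (hΩ : IsOpen Ω) {I : ℍ[ℝ]} (hI : I ∈ qSphere) (p : ℍ[ℝ]) {z : ℂ}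
    (hz : toSlice I z ∈ Ω) :
    DifferentiableAt ℂ (fun w => sliceFunctional I p (f (toSlice I w))) z := by
  obtain ⟨D, hD, hCR⟩ := hf.exists_hasFDerivAt hΩ hI hz
  have h := (sliceFunctional I p).hasFDerivAt.comp z hD
  rw [differentiableAt_complex_iff_differentiableAt_real]
  refine ⟨h.differentiableAt, ?_⟩
  have h' : fderiv ℝ (fun w => sliceFunctional I p (f (toSlice I w))) z =
    sliceFunctional I p ∘L D := h.fderiv
  simp [h', hCR, sliceFunctional_mul hI]

/-- Boundary maximum modulus principle on bounded slice domains. -/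
theorem boundary_maximum_modulus
    (Ω : Set ℍ[ℝ]) (hΩ : IsSliceDomain Ω) (hb : Bornology.IsBounded Ω)
    (f : ℍ[ℝ] → ℍ[ℝ]) (hf : SliceRegularOn f Ω)
    (M : ℝ)
    (hM : ∀ q₀ ∈ frontier Ω, ∀ ε > 0, ∀ᶠ q in nhdsWithin q₀ Ω, ‖f q‖ ≤ M + ε) :
    ∀ q ∈ Ω, ‖f q‖ ≤ M := by
  intro q hq
  refine le_of_forall_pos_le_add fun ε hε => ?_
  by_contra! hlt
  have hΩo : IsOpen Ω := hΩ.1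
  obtain ⟨I, hI, z, rfl⟩ := exists_toSlice_eq q
  have hcont : ContinuousOn (fun w => f (toSlice I w)) (toSlice I ⁻¹' Ω) := fun w hw => by
    obtain ⟨D, hD, -⟩ := hf.exists_hasFDerivAt hΩo hI hw
    exact hD.continuousAt.continuousWithinAt
  set V : Set ℂ := {w | toSlice I w ∈ Ω ∧ M + ε < ‖f (toSlice I w)‖} with hV
  have hVo : IsOpen V := hcont.norm.isOpen_inter_preimage
    (hΩo.preimage (continuous_toSlice I)) isOpen_Ioi
  have hVb : Bornology.IsBounded V := by
    obtain ⟨C, hC⟩ := hb.exists_norm_le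
    exact isBounded_iff_forall_norm_le.2
      ⟨C, fun w hw => (norm_toSlice hI w).symm.trans_le (hC _ hw.1)⟩
  have hVΩ : ∀ w ∈ closure V, toSlice I w ∈ Ω := fun w hw => by
    by_contra hn
    have htends : Filter.Tendsto (toSlice I) (nhdsWithin w V) (nhdsWithin (toSlice I w) Ω) :=
      (continuous_toSlice I).continuousWithinAt.tendsto_nhdsWithin fun x hx => hx.1
    have hcl : toSlice I w ∈ closure Ω :=
      map_mem_closure (continuous_toSlice I) hw fun x hx => hx.1
    have hfr : toSlice I w ∈ frontier Ω := ⟨hcl, hΩo.interior_eq.symm ▸ hn⟩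
    have : (nhdsWithin w V).NeBot := mem_closure_iff_nhdsWithin_neBot.1 hw
    obtain ⟨x, hx, hxV⟩ :=
      ((htends.eventually (hM _ hfr ε hε)).and self_mem_nhdsWithin).exists
    exact hx.not_gt hxV.2
  set p := f (toSlice I z) with hp
  have hd : DiffContOnCl ℂ (fun w => sliceFunctional I p (f (toSlice I w))) V :=
    DifferentiableOn.diffContOnCl fun w hw =>
      (hf.differentiableAt_sliceFunctional hΩo hI p (hVΩ w hw)).differentiableWithinAt
  have hzV : z ∈ V := ⟨hq, hlt⟩
  obtain ⟨w, hw, hmax⟩ := Complex.exists_mem_frontier_isMaxOn_norm hVb ⟨z, hzV⟩ hd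
  have hwM : ‖f (toSlice I w)‖ ≤ M + ε := by
    by_contra! hlt'
    exact hw.2 (hVo.interior_eq.symm ▸ ⟨hVΩ w hw.1, hlt'⟩)
  have hle : ‖p‖ * ‖p‖ ≤ ‖p‖ * ‖f (toSlice I w)‖ := by
    calc ‖p‖ * ‖p‖ = (sliceFunctional I p p).re := by
          rw [re_sliceFunctional, real_inner_self_eq_norm_mul_norm]
      _ ≤ ‖sliceFunctional I p p‖ := Complex.re_le_norm _
      _ ≤ ‖sliceFunctional I p (f (toSlice I w))‖ := hmax (subset_closure hzV)
      _ ≤ ‖p‖ * ‖f (toSlice I w)‖ := norm_sliceFunctional_le hI _ _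
  have hwp : ‖f (toSlice I w)‖ < ‖p‖ := hwM.trans_lt hlt
  exact hwp.not_ge (le_of_mul_le_mul_left hle ((norm_nonneg _).trans_lt hwp))
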